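/- Let β ≥ 0 and ε > 0 satisfy β + ε < 3/2. Then there exist constants c > 0 and R > 0 such that for every x ∈ ℝ³ with |x| ≥ R, ∫_{{y ∈ ℝ³ : |y| ≤ |x|/2}} (4π|x−y|)^{−1} ⟨y⟩^{−β − 3/2 − ε} dy ≥ c ⟨x⟩^{1/2 − β − ε}. -/

import Mathlib

open MeasureTheory Real

noncomputable section

/-- The Japanese bracket `⟨x⟩ = (1 + |x|²)^{1/2}` on `ℝ³`. -/
def jap (x : EuclideanSpace ℝ (Fin 3)) : ℝ := Real.sqrt (1 + ‖x‖ ^ 2)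

end

lemma one_le_jap (x : EuclideanSpace ℝ (Fin 3)) : 1 ≤ jap x :=
  Real.one_le_sqrt.mpr (by nlinarith [sq_nonneg ‖x‖])

lemma jap_pos (x : EuclideanSpace ℝ (Fin 3)) : 0 < jap x :=
  one_pos.trans_le (one_le_jap x)

lemma continuous_jap : Continuous jap := by
  unfold jap
  fun_prop

lemma jap_le_jap {x y : EuclideanSpace ℝ (Fin 3)} (h : ‖y‖ ≤ ‖x‖) : jap y ≤ jap x := by
  unfold jap
  gcongr

lemma norm_le_jap (x : EuclideanSpace ℝ (Fin 3)) : ‖x‖ ≤ jap x :=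
  Real.le_sqrt_of_sq_le (by linarith)

lemma jap_le_two_mul_norm {x : EuclideanSpace ℝ (Fin 3)} (h : 1 ≤ ‖x‖) : jap x ≤ 2 * ‖x‖ :=
  Real.sqrt_le_iff.mpr ⟨by positivity, by nlinarith⟩

/-- For `β ≥ 0`, `ε > 0` with `β + ε < 3/2`, the Newtonian potential of `⟨y⟩^{-β-3/2-ε}`
restricted to `{|y| ≤ |x|/2}` is bounded below by `c ⟨x⟩^{1/2-β-ε}` for large `|x|`. -/
theorem truncated_potential_lower_bound (β ε : ℝ) (hβ : 0 ≤ β) (hε : 0 < ε)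
    (hβε : β + ε < 3 / 2) :
    ∃ c > 0, ∃ R > 0, ∀ x : EuclideanSpace ℝ (Fin 3), R ≤ ‖x‖ →
      c * jap x ^ (1 / 2 - β - ε) ≤
        ∫ y in {y : EuclideanSpace ℝ (Fin 3) | ‖y‖ ≤ ‖x‖ / 2},
          (4 * π * ‖x - y‖)⁻¹ * jap y ^ (-β - 3 / 2 - ε) := by
  set V : ℝ := volume.real (Metric.ball (0 : EuclideanSpace ℝ (Fin 3)) 1) with hV
  have hVpos : 0 < V :=
    ENNReal.toReal_pos (Metric.measure_ball_pos _ _ one_pos).ne' measure_ball_lt_top.ne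
  refine ⟨(8 * π)⁻¹ * (V / 64), by positivity, 1, one_pos, fun x hx => ?_⟩
  have hset : {y : EuclideanSpace ℝ (Fin 3) | ‖y‖ ≤ ‖x‖ / 2} = Metric.closedBall 0 (‖x‖ / 2) := by
    ext y
    simp
  have hJ := jap_pos x
  have hdist : ∀ y ∈ Metric.closedBall (0 : EuclideanSpace ℝ (Fin 3)) (‖x‖ / 2),
      0 < ‖x - y‖ ∧ ‖x - y‖ ≤ 2 * jap x := fun y hy => by
    have hy' : ‖y‖ ≤ ‖x‖ / 2 := by simpa using hy
    constructor
    · linarith [norm_sub_norm_le x y]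
    · linarith [norm_sub_le x y, norm_le_jap x]
  have hint : IntegrableOn (fun y => (4 * π * ‖x - y‖)⁻¹ * jap y ^ (-β - 3 / 2 - ε))
      (Metric.closedBall (0 : EuclideanSpace ℝ (Fin 3)) (‖x‖ / 2)) := by
    refine ContinuousOn.integrableOn_compact (isCompact_closedBall _ _) ?_
    refine ContinuousOn.mul (ContinuousOn.inv₀ (by fun_prop) fun y hy => ?_)
      (continuous_jap.continuousOn.rpow_const fun y _ => Or.inl (jap_pos y).ne')
    have := (hdist y hy).1
    positivity
  have hlower : ∀ y ∈ Metric.closedBall (0 : EuclideanSpace ℝ (Fin 3)) (‖x‖ / 2),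
      (4 * π * (2 * jap x))⁻¹ * jap x ^ (-β - 3 / 2 - ε) ≤
        (4 * π * ‖x - y‖)⁻¹ * jap y ^ (-β - 3 / 2 - ε) := fun y hy => by
    obtain ⟨h0, h1⟩ := hdist y hy
    have hy' : ‖y‖ ≤ ‖x‖ / 2 := by simpa using hy
    have hpow : jap x ^ (-β - 3 / 2 - ε) ≤ jap y ^ (-β - 3 / 2 - ε) :=
      Real.rpow_le_rpow_of_nonpos (jap_pos y) (jap_le_jap (by linarith)) (by linarith)
    have := Real.rpow_nonneg hJ.le (-β - 3 / 2 - ε)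
    gcongr
  have hvol : volume.real (Metric.closedBall (0 : EuclideanSpace ℝ (Fin 3)) (‖x‖ / 2)) =
      (‖x‖ / 2) ^ 3 * V := by
    rw [Measure.addHaar_real_closedBall _ _ (by positivity)]
    simp [hV]
  rw [hset]
  refine le_trans ?_ (setIntegral_ge_of_const_le_real Metric.isClosed_closedBall.measurableSet
    measure_closedBall_lt_top.ne hlower hint)
  have hsplit : jap x ^ (1 / 2 - β - ε) = jap x ^ (-β - 3 / 2 - ε) * jap x ^ 2 := by
    rw [← Real.rpow_natCast, ← Real.rpow_add hJ]
    congr 1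
    push_cast
    ring
  have hcube : jap x ^ 3 / 64 ≤ (‖x‖ / 2) ^ 3 := by
    have := pow_le_pow_left₀ hJ.le (jap_le_two_mul_norm hx) 3
    nlinarith
  calc (8 * π)⁻¹ * (V / 64) * jap x ^ (1 / 2 - β - ε)
      = (4 * π * (2 * jap x))⁻¹ * jap x ^ (-β - 3 / 2 - ε) * (jap x ^ 3 / 64 * V) := by
        rw [hsplit]
        field_simp
        norm_num
    _ ≤ _ := by
        rw [hvol]
        gcongr
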